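/- arXiv:2109.11395 — 2 statements merged into one kernel-verified Lean document; each statement's English description precedes it below -/
import Mathlib

section
/- (Capture theorem.) Let f : ℝ^m → ℝ be a C³ function and let x_∞' be a non-degenerate local minimum of f (i.e. ∇f(x_∞') = 0, ∇²f(x_∞') is invertible, and x_∞' is a local minimum). Then there exists an open neighborhood U of x_∞' such that for every initial point x_0' ∈ U, every sequence {x_n'} generated by New Q-Newton's method Backtracking G from x_0' converges to x_∞'. -/
open scoped RealInnerProductSpace
open Filter Topology

noncomputable section

/-- ℝ^m with the Euclidean inner product and norm. -/
abbrev Euc (m : ℕ) := EuclideanSpace ℝ (Fin m)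

/-- `minsp A = min_{‖e‖=1} ‖A e‖`. -/
def minsp {m : ℕ} (A : Euc m →L[ℝ] Euc m) : ℝ :=
  sInf {r : ℝ | ∃ e : Euc m, ‖e‖ = 1 ∧ r = ‖A e‖}

/-- `κ = (1/2) · min_{i≠j} |δ_i − δ_j|`. -/
def kappa {m : ℕ} (δ : Fin (m + 1) → ℝ) : ℝ :=
  (1 / 2) * sInf {r : ℝ | ∃ i j : Fin (m + 1), i ≠ j ∧ r = |δ i - δ j|}

/-- The Hessian `∇²f(x)` of `f` at `x`, as a continuous linear map
(the derivative of the gradient). -/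
def hessOp {m : ℕ} (f : Euc m → ℝ) (x : Euc m) : Euc m →L[ℝ] Euc m :=
  fderiv ℝ (gradient f) x

/-- `A(x) = ∇²f(x) + δ_j ‖∇f(x)‖^τ · Id`. -/
def Aop {m : ℕ} (f : Euc m → ℝ) (δj τ : ℝ) (x : Euc m) : Euc m →L[ℝ] Euc m :=
  hessOp f x + (δj * ‖gradient f x‖ ^ τ) • ContinuousLinearMap.id ℝ (Euc m)

/-- The index `j` is acceptable at `x`: `minsp(∇²f(x) + δ_j‖∇f(x)‖^τ Id) ≥ κ‖∇f(x)‖^τ`. -/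
def goodIdx {m : ℕ} (δ : Fin (m + 1) → ℝ) (τ : ℝ) (f : Euc m → ℝ) (x : Euc m)
    (j : Fin (m + 1)) : Prop :=
  kappa δ * ‖gradient f x‖ ^ τ ≤ minsp (Aop f (δ j) τ x)

/-- The step direction `w = Σᵢ (⟨∇f(x), eᵢ⟩/‖A eᵢ‖) eᵢ`. -/
def dirW {m : ℕ} (f : Euc m → ℝ) (A : Euc m →L[ℝ] Euc m) (e : Fin m → Euc m) (x : Euc m) :
    Euc m :=
  ∑ i : Fin m, (⟪gradient f x, e i⟫ / ‖A (e i)‖) • e i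

/-- The normalised step direction `ŵ = w / max{1, ‖w‖}`. -/
def hatW {m : ℕ} (f : Euc m → ℝ) (A : Euc m →L[ℝ] Euc m) (e : Fin m → Euc m) (x : Euc m) :
    Euc m :=
  (max 1 ‖dirW f A e x‖)⁻¹ • dirW f A e x

/-- Armijo's condition: `f(x − γ v) − f(x) ≤ −(1/3) γ ⟨v, ∇f(x)⟩`. -/
def armijo {m : ℕ} (f : Euc m → ℝ) (x v : Euc m) (γ : ℝ) : Prop :=
  f (x - γ • v) - f x ≤ -(γ * ⟪v, gradient f x⟫) / 3

/-- One step of New Q-Newton's method Backtracking G, with orthonormal basis `e`,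
selected index `j` (the least acceptable index), current point `x` and next point `x'`. -/
def IsQNGStep {m : ℕ} (δ : Fin (m + 1) → ℝ) (τ γ0 : ℝ) (f : Euc m → ℝ)
    (e : Fin m → Euc m) (j : Fin (m + 1)) (x x' : Euc m) : Prop :=
  (gradient f x = 0 → x' = x) ∧
  (gradient f x ≠ 0 →
    goodIdx δ τ f x j ∧ (∀ j' : Fin (m + 1), j' < j → ¬ goodIdx δ τ f x j') ∧
    ∃ p : ℕ,
      armijo f x (hatW f (Aop f (δ j) τ x) e x) (γ0 * (1 / 3) ^ p) ∧
      (∀ q : ℕ, q < p → ¬ armijo f x (hatW f (Aop f (δ j) τ x) e x) (γ0 * (1 / 3) ^ q)) ∧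
      x' = x - (γ0 * (1 / 3) ^ p) • hatW f (Aop f (δ j) τ x) e x)

/-- `x : ℕ → ℝ^m` is generated by New Q-Newton's method Backtracking G, with
orthonormal bases `e n` and selected indices `j n` at step `n`. -/
def IsQNGSeq {m : ℕ} (δ : Fin (m + 1) → ℝ) (τ γ0 : ℝ) (f : Euc m → ℝ)
    (e : ℕ → Fin m → Euc m) (j : ℕ → Fin (m + 1)) (x : ℕ → Euc m) : Prop :=
  ∀ n : ℕ, Orthonormal ℝ (e n) ∧ IsQNGStep δ τ γ0 f (e n) (j n) (x n) (x (n + 1))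


lemma mvt_grad {m : ℕ} {f : Euc m → ℝ} (hf : Differentiable ℝ f) (x v : Euc m) :
    ∃ t : ℝ, 0 < t ∧ t < 1 ∧ f (x + v) - f x = ⟪gradient f (x + t • v), v⟫ := by
  have hd : ∀ t : ℝ, HasDerivAt (fun s : ℝ => f (x + s • v)) ⟪gradient f (x + t • v), v⟫ t := by
    intro t
    have h1 := (hf (x + t • v)).hasGradientAt.hasFDerivAt
    have h2 : HasDerivAt (fun s : ℝ => x + s • v) v t := by
      simpa using ((hasDerivAt_id t).smul_const v).const_add x
    have := h1.comp_hasDerivAt t h2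
    exact this
  obtain ⟨t, ht, h⟩ := exists_hasDerivAt_eq_slope (fun s : ℝ => f (x + s • v))
    (fun t => ⟪gradient f (x + t • v), v⟫) one_pos
    (fun t _ => (hd t).continuousAt.continuousWithinAt) (fun t _ => hd t)
  refine ⟨t, ht.1, ht.2, ?_⟩
  simp only [one_smul, zero_smul, add_zero, sub_zero, div_one] at h
  exact h.symm

lemma grad_contDiff {m : ℕ} {f : Euc m → ℝ} (hf : ContDiff ℝ 3 f) :
    ContDiff ℝ 2 (gradient f) := by
  have h : ContDiff ℝ 2 (fderiv ℝ f) := hf.fderiv_right (by norm_num)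
  exact (InnerProductSpace.toDual ℝ (Euc m)).symm.contDiff.comp h

lemma hess_symm {m : ℕ} {f : Euc m → ℝ} (hf : ContDiff ℝ 3 f) (x u v : Euc m) :
    ⟪hessOp f x u, v⟫ = ⟪hessOp f x v, u⟫ := by
  have h : ContDiff ℝ 2 (fderiv ℝ f) := hf.fderiv_right (by norm_num)
  have hs : IsSymmSndFDerivAt ℝ f x :=
    hf.contDiffAt.isSymmSndFDerivAt (by simp; norm_num)
  have key : ∀ u v : Euc m, ⟪hessOp f x u, v⟫ = fderiv ℝ (fderiv ℝ f) x u v := by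
    intro u v
    have h1 : HasFDerivAt (fderiv ℝ f) (fderiv ℝ (fderiv ℝ f) x) x :=
      (h.differentiable (by norm_num) x).hasFDerivAt
    have h3 := ((InnerProductSpace.toDual ℝ (Euc m)).symm.toContinuousLinearEquiv.toContinuousLinearMap.restrictScalars ℝ).hasFDerivAt.comp x h1
    have h2 : hessOp f x = _ := h3.fderiv
    rw [h2]
    simp
  rw [key, key]
  exact hs u v

lemma strict_bound {m : ℕ} {f : Euc m → ℝ} (hf : ContDiff ℝ 3 f) (x0 : Euc m) {ε : ℝ}
    (hε : 0 < ε) : ∃ R > 0, ∀ x ∈ Metric.ball x0 R, ∀ y ∈ Metric.ball x0 R,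
      ‖gradient f x - gradient f y - hessOp f x0 (x - y)‖ ≤ ε * ‖x - y‖ := by
  have h1 : HasStrictFDerivAt (gradient f) (hessOp f x0) x0 :=
    (grad_contDiff hf).contDiffAt.hasStrictFDerivAt (by norm_num)
  have h2 := h1.isLittleO.def hε
  obtain ⟨R, hR, hb⟩ := Metric.eventually_nhds_iff_ball.1 h2
  refine ⟨R, hR, fun x hx y hy => ?_⟩
  have hxy : (x, y) ∈ Metric.ball (x0, x0) R := by
    rw [← ball_prod_same]; exact ⟨hx, hy⟩
  have h3 := hb (x, y) hxy
  simpa only using h3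

lemma hess_nonneg {m : ℕ} {f : Euc m → ℝ} (hf : ContDiff ℝ 3 f) {x0 : Euc m}
    (hcrit : gradient f x0 = 0) (hmin : IsLocalMin f x0) (v : Euc m) :
    0 ≤ ⟪hessOp f x0 v, v⟫ := by
  by_contra! hneg
  have hv : v ≠ 0 := by rintro rfl; simp at hneg
  have hv' : 0 < ‖v‖ := norm_pos_iff.2 hv
  set a := -⟪hessOp f x0 v, v⟫ with ha
  have ha0 : 0 < a := by linarith
  obtain ⟨R, hR, hb⟩ := strict_bound hf x0 (ε := a / (2 * ‖v‖ ^ 2)) (by positivity)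
  obtain ⟨R', hR', hb'⟩ := Metric.eventually_nhds_iff_ball.1 hmin
  set s := min R R' / (2 * ‖v‖) with hs
  have hs0 : 0 < s := by have := lt_min hR hR'; positivity
  have hsv : s * ‖v‖ = min R R' / 2 := by rw [hs]; field_simp
  have hmn := lt_min hR hR'
  have h1 := hb' (x0 + s • v) (by
    simp [norm_smul, abs_of_pos hs0]; rw [hsv]; linarith [min_le_right R R'])
  obtain ⟨t, ht0, ht1, h⟩ := mvt_grad (hf.differentiable (by norm_num)) x0 (s • v)
  have h2 := hb (x0 + t • s • v) (by
    simp [norm_smul, abs_of_pos hs0, abs_of_pos ht0]; rw [hsv]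
    nlinarith [min_le_left R R']) x0 (by simpa using hR)
  rw [hcrit] at h2
  have h3 : (x0 + t • s • v) - x0 = (t * s) • v := by simp [smul_smul]
  rw [h3, sub_zero, map_smul, norm_smul, Real.norm_of_nonneg (by positivity)] at h2
  set G := gradient f (x0 + t • s • v)
  have h4 := real_inner_le_norm (G - (t * s) • hessOp f x0 v) v
  rw [inner_sub_left, real_inner_smul_left] at h4
  rw [real_inner_smul_right] at h
  have h5 : ‖G - (t * s) • hessOp f x0 v‖ * ‖v‖ ≤ t * s * (a / 2) := by
    calc _ ≤ (a / (2 * ‖v‖ ^ 2) * (t * s * ‖v‖)) * ‖v‖ := by gcongr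
      _ = _ := by field_simp
  have hts : 0 < t * s := by positivity
  have h6 : ⟪G, v⟫ < 0 := by nlinarith
  nlinarith

lemma hess_pos {m : ℕ} {f : Euc m → ℝ} (hf : ContDiff ℝ 3 f) {x0 : Euc m}
    (hcrit : gradient f x0 = 0) (hmin : IsLocalMin f x0) (hnd : IsUnit (hessOp f x0))
    (v : Euc m) (hv : v ≠ 0) : 0 < ⟪hessOp f x0 v, v⟫ := by
  have hn := hess_nonneg hf hcrit hmin
  refine lt_of_le_of_ne (hn v) fun h0 => hv ?_
  set H := hessOp f x0
  have h1 : ∀ t : ℝ, 0 ≤ 2 * t * ‖H v‖ ^ 2 + t ^ 2 * ⟪H (H v), H v⟫ := by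
    intro t
    have h := hn (v + t • H v)
    have hs := hess_symm hf x0 (H v) v
    simp only [map_add, map_smul, inner_add_left, inner_add_right, real_inner_smul_left,
      real_inner_smul_right] at h
    have : ⟪H v, H v⟫ = ‖H v‖ ^ 2 := real_inner_self_eq_norm_sq _
    change ⟪H (H v), v⟫ = ⟪H v, H v⟫ at hs
    change 0 ≤ ⟪H v, v⟫ + t * ⟪H (H v), v⟫ + (t * ⟪H v, H v⟫ + t * (t * ⟪H (H v), H v⟫)) at h
    rw [hs, this, ← h0] at h
    nlinarith
  have h2 : H v = 0 := by
    by_contra hne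
    have hp : 0 < ‖H v‖ ^ 2 := by have := norm_pos_iff.2 hne; positivity
    have hq : 0 ≤ ⟪H (H v), H v⟫ := hn _
    set q := ⟪H (H v), H v⟫
    have h := h1 (-(‖H v‖ ^ 2 / (q + 1)))
    have h' : 2 * (-(‖H v‖ ^ 2 / (q + 1))) * ‖H v‖ ^ 2 + (-(‖H v‖ ^ 2 / (q + 1))) ^ 2 * q
        = -(‖H v‖ ^ 2) ^ 2 * (q + 2) / (q + 1) ^ 2 := by field_simp; ring
    rw [h'] at h
    have : 0 < (‖H v‖ ^ 2) ^ 2 * (q + 2) / (q + 1) ^ 2 := by positivity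
    rw [neg_mul, neg_div] at h
    linarith
  obtain ⟨u, hu⟩ := hnd
  have h3 : (↑u⁻¹ : Euc m →L[ℝ] Euc m) (H v) = v := by
    have : (↑u⁻¹ * ↑u : Euc m →L[ℝ] Euc m) v = v := by rw [Units.inv_mul]; rfl
    rw [hu] at this
    exact this
  rw [← h3, h2, map_zero]

lemma hess_coercive {m : ℕ} {f : Euc m → ℝ} (hf : ContDiff ℝ 3 f) {x0 : Euc m}
    (hcrit : gradient f x0 = 0) (hmin : IsLocalMin f x0) (hnd : IsUnit (hessOp f x0)) :
    ∃ c > 0, ∀ v : Euc m, c * ‖v‖ ^ 2 ≤ ⟪hessOp f x0 v, v⟫ := by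
  have hp := hess_pos hf hcrit hmin hnd
  have hc : IsCompact (Metric.sphere (0 : Euc m) 1) := isCompact_sphere _ _
  rcases (Metric.sphere (0 : Euc m) 1).eq_empty_or_nonempty with he | hne
  · refine ⟨1, one_pos, fun v => ?_⟩
    by_cases hv : v = 0
    · simp [hv]
    · have : (‖v‖⁻¹ • v) ∈ Metric.sphere (0 : Euc m) 1 := by
        simp [norm_smul, hv]
      rw [he] at this
      exact this.elim
  · obtain ⟨e, he, hle⟩ := hc.exists_isMinOn hne
      (f := fun v => ⟪hessOp f x0 v, v⟫) (by fun_prop)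
    refine ⟨_, hp e (by rintro rfl; simp at he), fun v => ?_⟩
    by_cases hv : v = 0
    · simp [hv]
    · have hm : (‖v‖⁻¹ • v) ∈ Metric.sphere (0 : Euc m) 1 := by
        simp [norm_smul, hv]
      have h := hle hm
      have hv' : 0 < ‖v‖ := norm_pos_iff.2 hv
      simp only [Set.mem_ofPred_eq, map_smul, real_inner_smul_left, real_inner_smul_right] at h
      calc _ ≤ (‖v‖⁻¹ * (‖v‖⁻¹ * ⟪hessOp f x0 v, v⟫)) * ‖v‖ ^ 2 := by gcongr
        _ = _ := by field_simp

lemma dirW_bounds {m : ℕ} {f : Euc m → ℝ} {A : Euc m →L[ℝ] Euc m} {e : Fin m → Euc m}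
    (he : Orthonormal ℝ e) (x : Euc m) {a b : ℝ} (ha : 0 < a)
    (hA : ∀ i, a ≤ ‖A (e i)‖) (hA' : ∀ i, ‖A (e i)‖ ≤ b) :
    a * ‖dirW f A e x‖ ^ 2 ≤ ⟪dirW f A e x, gradient f x⟫ ∧
    ‖gradient f x‖ ^ 2 ≤ b * ⟪dirW f A e x, gradient f x⟫ := by
  set g := gradient f x
  have h1 : ‖dirW f A e x‖ ^ 2 = ∑ i, (⟪g, e i⟫ / ‖A (e i)‖) ^ 2 := by
    rw [← real_inner_self_eq_norm_sq, dirW, he.inner_sum]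
    refine Finset.sum_congr rfl fun i _ => ?_
    rw [sq]; rfl
  have h2 : ⟪dirW f A e x, g⟫ = ∑ i, ⟪g, e i⟫ ^ 2 / ‖A (e i)‖ := by
    rw [dirW, sum_inner]
    refine Finset.sum_congr rfl fun i _ => ?_
    rw [real_inner_smul_left, real_inner_comm]
    change ⟪e i, g⟫ / _ * ⟪e i, g⟫ = _
    rw [real_inner_comm]; ring
  have h3 : ‖g‖ ^ 2 = ∑ i, ⟪g, e i⟫ ^ 2 := by
    have hc : Fintype.card (Fin m) = Module.finrank ℝ (Euc m) := by simp
    have hsp : ⊤ ≤ Submodule.span ℝ (Set.range e) :=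
      (he.linearIndependent.span_eq_top_of_card_eq_finrank' hc).ge
    have := (OrthonormalBasis.mk he hsp).sum_sq_norm_inner_left g
    rw [← this]; simp
  rw [h1, h2, h3, Finset.mul_sum, Finset.mul_sum]
  constructor
  · refine Finset.sum_le_sum fun i _ => ?_
    have hp := ha.trans_le (hA i)
    have : ⟪g, e i⟫ ^ 2 / ‖A (e i)‖ = ‖A (e i)‖ * (⟪g, e i⟫ / ‖A (e i)‖) ^ 2 := by field_simp
    rw [this]
    gcongr
    exact hA i
  · refine Finset.sum_le_sum fun i _ => ?_
    have hp := ha.trans_le (hA i)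
    calc ⟪g, e i⟫ ^ 2 = ‖A (e i)‖ * (⟪g, e i⟫ ^ 2 / ‖A (e i)‖) := by field_simp
      _ ≤ _ := by gcongr; exact hA' i


lemma armijo_of_small {m : ℕ} {f : Euc m → ℝ} (hf : Differentiable ℝ f) {x0 x w : Euc m}
    {c L R γ : ℝ} (hc : 0 < c) (hL : 0 < L)
    (hlip : ∀ x ∈ Metric.ball x0 R, ∀ y ∈ Metric.ball x0 R,
      ‖gradient f x - gradient f y‖ ≤ L * ‖x - y‖)
    (hx : ‖x - x0‖ + ‖w‖ < R) (hγ0 : 0 < γ) (hγ1 : γ ≤ 1) (hγ : γ ≤ 2 * c / (3 * L))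
    (hw : c * ‖w‖ ^ 2 ≤ ⟪w, gradient f x⟫) : armijo f x w γ := by
  obtain ⟨t, ht0, ht1, h⟩ := mvt_grad hf x (-(γ • w))
  have hz : ‖t • -(γ • w)‖ ≤ γ * ‖w‖ := by
    rw [norm_smul, norm_neg, norm_smul, Real.norm_of_nonneg ht0.le, Real.norm_of_nonneg hγ0.le]
    have : 0 ≤ γ * ‖w‖ := by positivity
    nlinarith
  have hz' : γ * ‖w‖ ≤ ‖w‖ := by nlinarith [norm_nonneg w]
  have hl := hlip (x + t • -(γ • w)) (by
    rw [Metric.mem_ball, dist_eq_norm, add_sub_right_comm]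
    have := norm_add_le (x - x0) (t • -(γ • w))
    linarith) x (by
    rw [Metric.mem_ball, dist_eq_norm]
    linarith [norm_nonneg w])
  rw [add_sub_cancel_left] at hl
  set G := gradient f (x + t • -(γ • w))
  rw [armijo, sub_eq_add_neg x, h, inner_neg_right, real_inner_smul_right]
  have h4 := real_inner_le_norm (-(G - gradient f x)) w
  rw [inner_neg_left, inner_sub_left, norm_neg, real_inner_comm w (gradient f x)] at h4
  set P := ⟪w, gradient f x⟫
  have h5 : ‖G - gradient f x‖ * ‖w‖ ≤ (2 / 3) * P := by
    calc _ ≤ (L * (γ * ‖w‖)) * ‖w‖ := by gcongr; exact hl.trans (by gcongr)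
      _ = γ * (L * ‖w‖ ^ 2) := by ring
      _ ≤ (2 * c / (3 * L)) * (L * ‖w‖ ^ 2) := by gcongr
      _ = (2 / 3) * (c * ‖w‖ ^ 2) := by field_simp
      _ ≤ _ := by gcongr
  have h6 : (1 / 3) * P ≤ ⟪G, w⟫ := by linarith
  nlinarith

lemma Aop_tendsto {m : ℕ} {f : Euc m → ℝ} (hf : ContDiff ℝ 3 f) {x0 : Euc m}
    (hcrit : gradient f x0 = 0) {τ : ℝ} (hτ : 0 < τ) (d : ℝ) :
    Tendsto (Aop f d τ) (𝓝 x0) (𝓝 (hessOp f x0)) := by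
  have h1 : Continuous (gradient f) := (grad_contDiff hf).continuous
  have h2 : Continuous (hessOp f) := (grad_contDiff hf).continuous_fderiv (by norm_num)
  have h3 : Continuous (Aop f d τ) := by
    unfold Aop
    have h5 : Continuous fun x => d * ‖gradient f x‖ ^ τ :=
      continuous_const.mul (h1.norm.rpow_const fun _ => Or.inr hτ.le)
    exact h2.add (h5.smul continuous_const)
  have h4 : Aop f d τ x0 = hessOp f x0 := by
    ext v
    simp [Aop, hcrit, Real.zero_rpow hτ.ne']
  rw [← h4]
  exact h3.tendsto x0

lemma local_data {m : ℕ} (δ : Fin (m + 1) → ℝ) {τ : ℝ} (hτ : 0 < τ)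
    {f : Euc m → ℝ} (hf : ContDiff ℝ 3 f)
    {x0 : Euc m} (hcrit : gradient f x0 = 0) (hnd : IsUnit (hessOp f x0))
    (hmin : IsLocalMin f x0) :
    ∃ c > 0, ∃ L > 0, ∃ R > 0,
      (∀ x ∈ Metric.ball x0 R, ∀ y ∈ Metric.ball x0 R,
        ‖gradient f x - gradient f y‖ ≤ L * ‖x - y‖) ∧
      (∀ x ∈ Metric.ball x0 R, c * ‖x - x0‖ ^ 2 ≤ ⟪gradient f x, x - x0⟫) ∧
      (∀ x ∈ Metric.ball x0 R, f x0 ≤ f x) ∧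
      (∀ x ∈ Metric.ball x0 R, ∀ j, ∀ v : Euc m, ‖v‖ = 1 →
        c ≤ ‖Aop f (δ j) τ x v‖ ∧ ‖Aop f (δ j) τ x v‖ ≤ L) := by
  obtain ⟨c, hc, hcoer⟩ := hess_coercive hf hcrit hmin hnd
  set H := hessOp f x0 with hH
  obtain ⟨R1, hR1, hb1⟩ := strict_bound hf x0 (half_pos hc)
  obtain ⟨R2, hR2, hb2⟩ := Metric.eventually_nhds_iff_ball.1 hmin
  have h3 : ∀ᶠ x in 𝓝 x0, ∀ j, dist (Aop f (δ j) τ x) H < c / 2 := by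
    rw [Filter.eventually_all]
    intro j
    exact Metric.tendsto_nhds.1 (Aop_tendsto hf hcrit hτ (δ j)) _ (half_pos hc)
  obtain ⟨R3, hR3, hb3⟩ := Metric.eventually_nhds_iff_ball.1 h3
  have hlt := lt_min hR1 (lt_min hR2 hR3)
  refine ⟨c / 2, half_pos hc, ‖H‖ + c / 2, by positivity, min R1 (min R2 R3), hlt,
    ?_, ?_, ?_, ?_⟩
  · intro x hx y hy
    have h := hb1 x (Metric.ball_subset_ball (min_le_left _ _) hx) y
      (Metric.ball_subset_ball (min_le_left _ _) hy)
    have h' := H.le_opNorm (x - y)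
    have h'' := norm_add_le (gradient f x - gradient f y - H (x - y)) (H (x - y))
    rw [sub_add_cancel] at h''
    linarith
  · intro x hx
    have h := hb1 x (Metric.ball_subset_ball (min_le_left _ _) hx) x0
      (Metric.mem_ball_self hR1)
    rw [hcrit, sub_zero] at h
    have h4 := real_inner_le_norm (-(gradient f x - H (x - x0))) (x - x0)
    rw [inner_neg_left, inner_sub_left, norm_neg] at h4
    have h5 := hcoer (x - x0)
    have h6 := mul_le_mul_of_nonneg_right h (norm_nonneg (x - x0))
    nlinarith
  · intro x hx
    exact hb2 x (Metric.ball_subset_ball ((min_le_right _ _).trans (min_le_left _ _)) hx)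
  · intro x hx j v hv
    have h := hb3 x (Metric.ball_subset_ball ((min_le_right _ _).trans (min_le_right _ _)) hx) j
    rw [dist_eq_norm] at h
    have h1 := (Aop f (δ j) τ x - H).le_opNorm v
    have h2 := H.le_opNorm v
    have h4 := hcoer v
    have h5 := real_inner_le_norm (H v) v
    rw [hv, mul_one] at h1 h2 h5
    rw [hv] at h4
    have e1 : (Aop f (δ j) τ x - H) v = Aop f (δ j) τ x v - H v := rfl
    rw [e1] at h1
    have h6 := norm_sub_norm_le (H v) (Aop f (δ j) τ x v)
    have h7 := norm_sub_norm_le (Aop f (δ j) τ x v) (H v)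
    rw [norm_sub_rev] at h6
    constructor <;> linarith

lemma quad_lower {m : ℕ} {f : Euc m → ℝ} (hf : Differentiable ℝ f) {x0 : Euc m} {c R : ℝ}
    (hc : 0 < c)
    (hmono : ∀ x ∈ Metric.ball x0 R, c * ‖x - x0‖ ^ 2 ≤ ⟪gradient f x, x - x0⟫)
    (hle : ∀ x ∈ Metric.ball x0 R, f x0 ≤ f x) {x : Euc m} (hx : x ∈ Metric.ball x0 R) :
    c / 4 * ‖x - x0‖ ^ 2 ≤ f x - f x0 := by
  obtain ⟨v, rfl⟩ : ∃ v, x = x0 + v := ⟨x - x0, by simp⟩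
  have hv : ‖v‖ < R := by simpa using hx
  rw [add_sub_cancel_left]
  have hball : ∀ s : ℝ, 0 ≤ s → s ≤ 1 → x0 + s • v ∈ Metric.ball x0 R := by
    intro s hs hs1
    rw [Metric.mem_ball, dist_eq_norm, add_sub_cancel_left, norm_smul, Real.norm_of_nonneg hs]
    nlinarith [norm_nonneg v]
  obtain ⟨t, ht0, ht1, h⟩ := mvt_grad hf (x0 + (1 / 2 : ℝ) • v) ((1 / 2 : ℝ) • v)
  have e1 : x0 + (1 / 2 : ℝ) • v + (1 / 2 : ℝ) • v = x0 + v := by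
    rw [add_assoc, ← add_smul]; norm_num
  have e2 : x0 + (1 / 2 : ℝ) • v + t • (1 / 2 : ℝ) • v = x0 + (1 / 2 + t / 2) • v := by
    rw [add_assoc, smul_smul, ← add_smul]; congr 2; ring
  rw [e1, e2, real_inner_smul_right] at h
  have h1 := hle _ (hball (1 / 2) (by norm_num) (by norm_num))
  have h2 := hmono _ (hball (1 / 2 + t / 2) (by linarith) (by linarith))
  rw [add_sub_cancel_left, norm_smul, Real.norm_of_nonneg (by linarith),
    real_inner_smul_right] at h2
  set I := ⟪gradient f (x0 + (1 / 2 + t / 2) • v), v⟫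
  have hs : 0 < 1 / 2 + t / 2 := by linarith
  have h3 : c * ((1 / 2 + t / 2) * ‖v‖ ^ 2) ≤ I := by
    refine le_of_mul_le_mul_left ?_ hs
    linarith
  have h4 : 0 ≤ c * ‖v‖ ^ 2 := by positivity
  nlinarith

lemma step_decrease {m : ℕ} (δ : Fin (m + 1) → ℝ) {τ γ0 : ℝ}
    (hγ0 : 0 < γ0) (hγ1 : γ0 < 1) {f : Euc m → ℝ} (hf : Differentiable ℝ f)
    {x0 : Euc m} (hcrit : gradient f x0 = 0) {c L R : ℝ} (hc : 0 < c) (hL : 0 < L) (hR : 0 < R)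
    (hlip : ∀ x ∈ Metric.ball x0 R, ∀ y ∈ Metric.ball x0 R,
        ‖gradient f x - gradient f y‖ ≤ L * ‖x - y‖)
    (hmono : ∀ x ∈ Metric.ball x0 R, c * ‖x - x0‖ ^ 2 ≤ ⟪gradient f x, x - x0⟫)
    (hA : ∀ x ∈ Metric.ball x0 R, ∀ j, ∀ v : Euc m, ‖v‖ = 1 →
        c ≤ ‖Aop f (δ j) τ x v‖ ∧ ‖Aop f (δ j) τ x v‖ ≤ L)
    {e : Fin m → Euc m} (he : Orthonormal ℝ e) {j : Fin (m + 1)} {x x' : Euc m}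
    (hx1 : ‖x - x0‖ < R / (1 + L / c)) (hx2 : ‖x - x0‖ < c / L)
    (hstep : IsQNGStep δ τ γ0 f e j x x') :
    x' ∈ Metric.ball x0 R ∧
    f x' ≤ f x - min γ0 (2 * c / (9 * L)) * c ^ 2 / (3 * L) * ‖x - x0‖ ^ 2 := by
  set d := ‖x - x0‖ with hd
  have hd0 : 0 ≤ d := norm_nonneg _
  have hdR : d + L / c * d < R := by
    rw [lt_div_iff₀ (by positivity)] at hx1; linarith
  have hdL : L * d < c := by rw [lt_div_iff₀ hL] at hx2; linarith
  have hLcd : 0 ≤ L / c * d := by positivity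
  have hxR : x ∈ Metric.ball x0 R := by
    rw [Metric.mem_ball, dist_eq_norm]; linarith
  have hgL : ‖gradient f x‖ ≤ L * d := by
    simpa [hcrit] using hlip x hxR x0 (Metric.mem_ball_self hR)
  have hgc : c * d ≤ ‖gradient f x‖ := by
    have h1 := hmono x hxR
    have h2 := real_inner_le_norm (gradient f x) (x - x0)
    rcases hd0.eq_or_lt with h0 | h0
    · rw [← h0]; simp
    · refine le_of_mul_le_mul_right ?_ h0
      linarith
  by_cases hg : gradient f x = 0
  · rw [hg, norm_zero] at hgc
    have hd00 : d = 0 := by nlinarith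
    rw [hstep.1 hg]
    exact ⟨hxR, by rw [hd00]; simp⟩
  · obtain ⟨-, -, p, hp, hq, rfl⟩ := hstep.2 hg
    set w := dirW f (Aop f (δ j) τ x) e x with hw
    obtain ⟨hb1, hb2⟩ := dirW_bounds (f := f) he x hc
      (fun i => (hA x hxR j (e i) (he.1 i)).1) (fun i => (hA x hxR j (e i) (he.1 i)).2)
    rw [← hw] at hb1 hb2
    have hwg : c * ‖w‖ ≤ ‖gradient f x‖ := by
      have h2 := real_inner_le_norm w (gradient f x)
      rcases (norm_nonneg w).eq_or_lt with h0 | h0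
      · rw [← h0]; simp
      · refine le_of_mul_le_mul_right ?_ h0
        linarith
    have hw1 : ‖w‖ ≤ 1 := by
      by_contra! hcon
      nlinarith
    have hwd : ‖w‖ ≤ L / c * d := by
      rw [div_mul_eq_mul_div, le_div_iff₀ hc]; linarith
    have hhat : hatW f (Aop f (δ j) τ x) e x = w := by
      rw [hatW, ← hw, max_eq_left hw1]; simp
    rw [hhat] at hp hq ⊢
    have hsm : ‖x - x0‖ + ‖w‖ < R := by linarith
    set γ := γ0 * (1 / 3) ^ p with hγ
    have hγpos : 0 < γ := by positivity
    have hγle : γ ≤ 1 := by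
      have : (1 / 3 : ℝ) ^ p ≤ 1 := pow_le_one₀ (by norm_num) (by norm_num)
      nlinarith
    have hγmin : min γ0 (2 * c / (9 * L)) ≤ γ := by
      rcases p with _ | p
      · simp [hγ]
      · refine (min_le_right _ _).trans ?_
        have hn := hq p (Nat.lt_succ_self p)
        by_contra! hcon
        apply hn
        have h3 : γ0 * (1 / 3) ^ p = 3 * γ := by rw [hγ, pow_succ]; ring
        refine armijo_of_small hf hc hL hlip hsm (by positivity) ?_ ?_ hb1
        · have : (1 / 3 : ℝ) ^ p ≤ 1 := pow_le_one₀ (by norm_num) (by norm_num)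
          nlinarith
        · rw [h3]
          have : 2 * c / (3 * L) = 3 * (2 * c / (9 * L)) := by field_simp; norm_num
          rw [this]; linarith
    constructor
    · rw [Metric.mem_ball, dist_eq_norm, sub_right_comm]
      have h1 := norm_sub_le (x - x0) (γ • w)
      rw [norm_smul, Real.norm_of_nonneg hγpos.le] at h1
      nlinarith [norm_nonneg w]
    · rw [armijo] at hp
      set P := ⟪w, gradient f x⟫
      have hP : c ^ 2 * d ^ 2 / L ≤ P := by
        rw [div_le_iff₀ hL]
        have : (c * d) ^ 2 ≤ ‖gradient f x‖ ^ 2 := by gcongr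
        nlinarith
      have : min γ0 (2 * c / (9 * L)) * (c ^ 2 * d ^ 2 / L) ≤ γ * P := by
        gcongr
      have e3 : min γ0 (2 * c / (9 * L)) * c ^ 2 / (3 * L) * d ^ 2
        = min γ0 (2 * c / (9 * L)) * (c ^ 2 * d ^ 2 / L) / 3 := by field_simp
      rw [e3]; linarith

/-- (Capture theorem.) If `xinf` is a non-degenerate local minimum of `f`, then there is an
open neighbourhood `U` of `xinf` such that every sequence generated by New Q-Newton's method
Backtracking G from an initial point in `U` converges to `xinf`. -/
theorem stmt8 {m : ℕ} (hm : 1 ≤ m) (δ : Fin (m + 1) → ℝ) (hδ : Function.Injective δ)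
    (τ γ0 : ℝ) (hτ : 0 < τ) (hγ0 : 0 < γ0) (hγ1 : γ0 < 1)
    (f : Euc m → ℝ) (hf : ContDiff ℝ 3 f)
    (xinf : Euc m) (hcrit : gradient f xinf = 0) (hnd : IsUnit (hessOp f xinf))
    (hmin : IsLocalMin f xinf) :
    ∃ U : Set (Euc m), IsOpen U ∧ xinf ∈ U ∧
      ∀ (e : ℕ → Fin m → Euc m) (j : ℕ → Fin (m + 1)) (x : ℕ → Euc m),
        x 0 ∈ U → IsQNGSeq δ τ γ0 f e j x → Tendsto x atTop (𝓝 xinf) := by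
  have hfd : Differentiable ℝ f := hf.differentiable (by norm_num)
  obtain ⟨c, hc, L, hL, R, hR, hlip, hmono, hle, hA⟩ := local_data δ hτ hf hcrit hnd hmin
  set r := min (R / (1 + L / c)) (c / L) with hr
  have hr0 : 0 < r := lt_min (by positivity) (by positivity)
  have hrR : r ≤ R := by
    refine (min_le_left _ _).trans (div_le_self hR.le ?_)
    have : 0 < L / c := by positivity
    linarith
  set k := min γ0 (2 * c / (9 * L)) * c ^ 2 / (3 * L) with hk
  have hk0 : 0 < k := by
    have : 0 < min γ0 (2 * c / (9 * L)) := lt_min hγ0 (by positivity)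
    positivity
  refine ⟨Metric.ball xinf r ∩ {x | f x < f xinf + c / 4 * r ^ 2}, ?_, ?_, ?_⟩
  · exact Metric.isOpen_ball.inter (isOpen_lt hfd.continuous continuous_const)
  · exact ⟨Metric.mem_ball_self hr0, lt_add_of_pos_right (f xinf) (show 0 < c / 4 * r ^ 2 by positivity)⟩
  · intro e j x hx0 hseq
    have hdec : ∀ n, ‖x n - xinf‖ < r → x (n + 1) ∈ Metric.ball xinf R ∧
        f (x (n + 1)) ≤ f (x n) - k * ‖x n - xinf‖ ^ 2 := fun n hn =>
      step_decrease δ hγ0 hγ1 hfd hcrit hc hL hR hlip hmono hA (hseq n).1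
        (hn.trans_le (min_le_left _ _)) (hn.trans_le (min_le_right _ _)) (hseq n).2
    have hinv : ∀ n, ‖x n - xinf‖ < r ∧ f (x n) < f xinf + c / 4 * r ^ 2 := by
      intro n
      induction n with
      | zero => exact ⟨by simpa [dist_eq_norm] using hx0.1, hx0.2⟩
      | succ n ih =>
        obtain ⟨h1, h2⟩ := hdec n ih.1
        have h3 : 0 ≤ k * ‖x n - xinf‖ ^ 2 := by positivity
        have h4 : f (x (n + 1)) < f xinf + c / 4 * r ^ 2 := by linarith [ih.2]
        have h5 := quad_lower hfd hc hmono hle h1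
        refine ⟨?_, h4⟩
        refine lt_of_pow_lt_pow_left₀ 2 hr0.le ?_
        refine lt_of_mul_lt_mul_left (a := c / 4) ?_ (by positivity)
        linarith
    have hanti : Antitone fun n => f (x n) := by
      refine antitone_nat_of_succ_le fun n => ?_
      have h3 : 0 ≤ k * ‖x n - xinf‖ ^ 2 := by positivity
      linarith [(hdec n (hinv n).1).2]
    have hbdd : BddBelow (Set.range fun n => f (x n)) := by
      refine ⟨f xinf, ?_⟩
      rintro _ ⟨n, rfl⟩
      refine hle _ ?_
      rw [Metric.mem_ball, dist_eq_norm]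
      exact (hinv n).1.trans_le hrR
    have hlim := tendsto_atTop_ciInf hanti hbdd
    have hlim' := (hlim.sub (hlim.comp (tendsto_add_atTop_nat 1))).div_const k
    rw [sub_self, zero_div] at hlim'
    have hsq : Tendsto (fun n => ‖x n - xinf‖ ^ 2) atTop (𝓝 0) := by
      refine squeeze_zero (fun n => by positivity) (fun n => ?_) hlim'
      rw [le_div_iff₀ hk0]
      have := (hdec n (hinv n).1).2
      simp only [Function.comp]
      linarith
    rw [tendsto_iff_norm_sub_tendsto_zero]
    have h := hsq.sqrt
    simpa [Real.sqrt_sq (norm_nonneg _)] using h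
end
end

section
/- (Morse functions.) Let f : ℝ^m → ℝ be a C³ Morse function, i.e. every critical point x* of f (∇f(x*) = 0) has invertible Hessian ∇²f(x*). Assume the orthonormal basis used at each step of New Q-Newton's method Backtracking G is given by a fixed assignment x ↦ (e_1(x), …, e_m(x)), so that the update is x_{n+1} = H(x_n) for a fixed map H : ℝ^m → ℝ^m. Then there exists a set E ⊂ ℝ^m of Lebesgue measure 0 such that for every initial point x_0 ∉ E, the sequence {x_n} generated from x_0 satisfies: either lim_{n→∞} ‖x_n‖ = ∞, or {x_n} converges to a critical point of f. Moreover, if f has compact sublevels, then only the second alternative occurs. -/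
open scoped RealInnerProductSpace
open Filter Topology

noncomputable section

lemma aux_cluster {m : ℕ} (f : Euc m → ℝ) (hfc : Continuous f) (H : Euc m → Euc m)
    (hC : ∀ x, f (H x) ≤ f x)
    (hA : ∀ z, gradient f z ≠ 0 → ∃ d > 0, ∀ᶠ x in 𝓝 z, f (H x) ≤ f x - d)
    (x0 z : Euc m) (hz : MapClusterPt z atTop (fun n => H^[n] x0)) : gradient f z = 0 := by
  by_contra hne
  obtain ⟨d, hd, hev⟩ := hA z hne
  have hanti : Antitone (fun n => f (H^[n] x0)) := by
    apply antitone_nat_of_succ_le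
    intro n
    simp only [Function.iterate_succ_apply']
    exact hC _
  have hlow : ∀ n, f z ≤ f (H^[n] x0) := by
    intro n
    by_contra hlt
    push Not at hlt
    have h1 : ∀ᶠ y in 𝓝 z, f (H^[n] x0) < f y := hfc.continuousAt.eventually (lt_mem_nhds hlt)
    have h2 := (hz.frequently h1).and_eventually (eventually_ge_atTop n)
    obtain ⟨k, hk1, hk2⟩ := h2.exists
    exact absurd (hanti hk2) (not_le.mpr hk1)
  have h1 : ∀ᶠ y in 𝓝 z, f y < f z + d :=
    hfc.continuousAt.eventually (gt_mem_nhds (by linarith))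
  obtain ⟨k, hk1, hk2⟩ := (hz.frequently (h1.and hev)).exists
  have := hlow (k + 1)
  rw [Function.iterate_succ_apply'] at this
  linarith

lemma aux_conv {m : ℕ} (f : Euc m → ℝ) (H : Euc m → Euc m)
    (x0 z : Euc m) (hz : MapClusterPt z atTop (fun n => H^[n] x0))
    (hcrit : ∀ y, MapClusterPt y atTop (fun n => H^[n] x0) → gradient f y = 0)
    (hiso : ∀ᶠ y in 𝓝[≠] z, gradient f y ≠ 0)
    (hB : Tendsto H (𝓝 z) (𝓝 z)) : Tendsto (fun n => H^[n] x0) atTop (𝓝 z) := by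
  rw [eventually_nhdsWithin_iff, Metric.eventually_nhds_iff] at hiso
  obtain ⟨r, hr, hr2⟩ := hiso
  rw [Metric.tendsto_atTop]
  intro ε0 hε0
  obtain ⟨ε, hε, hεr, hεε⟩ : ∃ ε > 0, ε < r ∧ ε ≤ ε0 :=
    ⟨min (r / 2) ε0, by positivity, by
      have := min_le_left (r / 2) ε0
      linarith, min_le_right _ _⟩
  -- eventually, being in the ball implies staying in the ball
  have key : ∀ᶠ n in atTop, H^[n] x0 ∈ Metric.ball z ε → H^[n + 1] x0 ∈ Metric.ball z ε := by
    by_contra hcon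
    rw [not_eventually] at hcon
    have hball : ∀ᶠ y in 𝓝 z, H y ∈ Metric.ball z ε := hB (Metric.ball_mem_nhds z hε)
    obtain ⟨ρ, hρ, hρ2⟩ := Metric.eventually_nhds_iff.mp hball
    have hK : IsCompact (Metric.closedBall z ε \ Metric.ball z ρ) :=
      (isCompact_closedBall z ε).diff Metric.isOpen_ball
    have hfr : ∃ᶠ n in atTop, H^[n] x0 ∈ Metric.closedBall z ε \ Metric.ball z ρ := by
      refine hcon.mono ?_
      intro n hn
      push Not at hn
      refine ⟨Metric.ball_subset_closedBall hn.1, ?_⟩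
      intro hmem
      apply hn.2
      rw [Function.iterate_succ_apply']
      exact hρ2 hmem
    obtain ⟨y, hy, hyc⟩ := hK.exists_mapClusterPt_of_frequently hfr
    refine hr2 (y := y) ?_ ?_ (hcrit y hyc)
    · exact lt_of_le_of_lt hy.1 hεr
    · intro h
      apply hy.2
      rw [Set.mem_singleton_iff.mp h]
      exact Metric.mem_ball_self hρ
  obtain ⟨N, hN⟩ := eventually_atTop.mp key
  obtain ⟨k, hk1, hk2⟩ := ((hz.frequently (Metric.ball_mem_nhds z hε)).and_eventually
    (eventually_ge_atTop N)).exists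
  refine ⟨k, fun n hn => ?_⟩
  have : H^[n] x0 ∈ Metric.ball z ε := by
    induction n, hn using Nat.le_induction with
    | base => exact hk1
    | succ n hn ih => exact hN n (hk2.trans hn) ih
  exact lt_of_lt_of_le this hεε

lemma aux_minsp {m : ℕ} (A : Euc m →L[ℝ] Euc m) (v : Euc m) (hv : ‖v‖ = 1) :
    minsp A ≤ ‖A v‖ := by
  apply csInf_le
  · exact ⟨0, by rintro r ⟨u, -, rfl⟩; exact norm_nonneg _⟩
  · exact ⟨v, hv, rfl⟩

lemma aux_kappa {m : ℕ} (hm : 1 ≤ m) (δ : Fin (m + 1) → ℝ) (hδ : Function.Injective δ) :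
    0 < kappa δ := by
  unfold kappa
  have hfin : {r : ℝ | ∃ i j : Fin (m + 1), i ≠ j ∧ r = |δ i - δ j|}.Finite := by
    refine (Set.finite_range (fun p : Fin (m + 1) × Fin (m + 1) => |δ p.1 - δ p.2|)).subset ?_
    rintro r ⟨i, j, -, rfl⟩
    exact ⟨(i, j), rfl⟩
  have hne : {r : ℝ | ∃ i j : Fin (m + 1), i ≠ j ∧ r = |δ i - δ j|}.Nonempty :=
    ⟨_, 0, Fin.last m, by
      intro h
      have := congrArg Fin.val h
      simp at this
      omega, rfl⟩
  obtain ⟨i, j, hij, h⟩ := hne.csInf_mem hfin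
  rw [h]
  have : 0 < |δ i - δ j| := abs_pos.mpr (sub_ne_zero.mpr (hδ.ne hij))
  positivity

lemma aux_parseval {m : ℕ} (e : Fin m → Euc m) (he : Orthonormal ℝ e) (g : Euc m) :
    ∑ i, ⟪g, e i⟫ ^ 2 = ‖g‖ ^ 2 := by
  have hsp : ⊤ ≤ Submodule.span ℝ (Set.range e) := by
    rw [he.linearIndependent.span_eq_top_of_card_eq_finrank' (by simp)]
  have := (OrthonormalBasis.mk he hsp).sum_sq_norm_inner_left g
  simpa using this

lemma aux_inner {m : ℕ} (f : Euc m → ℝ) (A : Euc m →L[ℝ] Euc m) (e : Fin m → Euc m)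
    (x : Euc m) :
    ⟪dirW f A e x, gradient f x⟫ = ∑ i, ⟪gradient f x, e i⟫ ^ 2 / ‖A (e i)‖ := by
  unfold dirW
  rw [sum_inner]
  refine Finset.sum_congr rfl fun i _ => ?_
  rw [real_inner_smul_left, real_inner_comm]
  ring

lemma aux_hat_inner {m : ℕ} (f : Euc m → ℝ) (A : Euc m →L[ℝ] Euc m) (e : Fin m → Euc m)
    (x : Euc m) :
    0 ≤ ⟪hatW f A e x, gradient f x⟫ := by
  unfold hatW
  rw [real_inner_smul_left, aux_inner]
  positivity

lemma aux_hat_norm {m : ℕ} (f : Euc m → ℝ) (A : Euc m →L[ℝ] Euc m) (e : Fin m → Euc m)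
    (x : Euc m) : ‖hatW f A e x‖ ≤ 1 ∧ ‖hatW f A e x‖ ≤ ‖dirW f A e x‖ := by
  unfold hatW
  have h0 : 0 < max 1 ‖dirW f A e x‖ := lt_of_lt_of_le one_pos (le_max_left _ _)
  rw [norm_smul, norm_inv, Real.norm_of_nonneg h0.le, inv_mul_eq_div]
  constructor
  · rw [div_le_one h0]
    exact le_max_right _ _
  · exact div_le_self (norm_nonneg _) (le_max_left _ _)

lemma aux_dir_norm {m : ℕ} (f : Euc m → ℝ) (A : Euc m →L[ℝ] Euc m) (e : Fin m → Euc m)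
    (he : Orthonormal ℝ e) (x : Euc m) (c : ℝ) (hc : 0 < c) (hA : ∀ v, ‖v‖ = 1 → c ≤ ‖A v‖) :
    ‖dirW f A e x‖ ≤ m * (‖gradient f x‖ / c) := by
  unfold dirW
  refine (norm_sum_le _ _).trans ?_
  refine (Finset.sum_le_card_nsmul _ _ (‖gradient f x‖ / c) ?_).trans (by simp)
  intro i _
  rw [norm_smul, he.1 i, mul_one, norm_div, norm_norm]
  have h1 : ‖⟪gradient f x, e i⟫‖ ≤ ‖gradient f x‖ := by
    have := norm_inner_le_norm (𝕜 := ℝ) (gradient f x) (e i)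
    rwa [he.1 i, mul_one] at this
  exact div_le_div₀ (norm_nonneg _) h1 hc (hA _ (he.1 i))

lemma aux_grad {m : ℕ} (f : Euc m → ℝ) (hf : ContDiff ℝ 3 f) : ContDiff ℝ 2 (gradient f) := by
  have h : ContDiff ℝ 2 (fderiv ℝ f) := hf.fderiv_right (by norm_num)
  exact (InnerProductSpace.toDual ℝ (Euc m)).symm.toContinuousLinearEquiv.contDiff.comp h

lemma aux_A {m : ℕ} (f : Euc m → ℝ) (hf : ContDiff ℝ 3 f) (d τ : ℝ) (hτ : 0 < τ) :
    Continuous (Aop f d τ) := by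
  have h := aux_grad f hf
  have h2 : Continuous (hessOp f) := h.continuous_fderiv (by norm_num)
  have h3 : Continuous (fun x => ‖gradient f x‖ ^ τ) :=
    h.continuous.norm.rpow_const (fun _ => Or.inr hτ.le)
  unfold Aop
  exact h2.add ((continuous_const.mul h3).smul continuous_const)

lemma aux_B {m : ℕ} (δ : Fin (m + 1) → ℝ)
    (τ γ0 : ℝ) (hτ : 0 < τ) (hγ0 : 0 < γ0) (hγ1 : γ0 < 1)
    (f : Euc m → ℝ) (hf : ContDiff ℝ 3 f)
    (e : Euc m → Fin m → Euc m) (j : Euc m → Fin (m + 1)) (H : Euc m → Euc m)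
    (he : ∀ z : Euc m, Orthonormal ℝ (e z))
    (hH : ∀ z : Euc m, IsQNGStep δ τ γ0 f (e z) (j z) z (H z))
    (z : Euc m) (hz : gradient f z = 0) (C : ℝ) (hC : 0 < C)
    (hinv : ∀ v, ‖v‖ ≤ C * ‖hessOp f z v‖) : Tendsto H (𝓝 z) (𝓝 z) := by
  have hev : ∀ᶠ x in 𝓝 z, ∀ i, ‖Aop f (δ i) τ x - hessOp f z‖ < 1 / (2 * C) := by
    rw [eventually_all]
    intro i
    have h1 : Aop f (δ i) τ z = hessOp f z := by
      unfold Aop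
      rw [hz, norm_zero, Real.zero_rpow hτ.ne', mul_zero]
      ext v
      simp
    have h2 := (aux_A f hf (δ i) τ hτ).tendsto z
    rw [h1, Metric.tendsto_nhds] at h2
    have := h2 (1 / (2 * C)) (by positivity)
    simpa [dist_eq_norm] using this
  have hbd : ∀ᶠ x in 𝓝 z, ‖H x - x‖ ≤ m * (‖gradient f x‖ / (1 / (2 * C))) := by
    filter_upwards [hev] with x hx
    by_cases hg : gradient f x = 0
    · rw [(hH x).1 hg]
      simp [hg]
    · obtain ⟨-, -, p, -, -, hp⟩ := (hH x).2 hg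
      rw [hp, sub_sub_cancel_left, norm_neg, norm_smul]
      have hγ : ‖γ0 * (1 / 3) ^ p‖ ≤ 1 := by
        rw [Real.norm_of_nonneg (by positivity)]
        have : ((1:ℝ) / 3) ^ p ≤ 1 := pow_le_one₀ (by norm_num) (by norm_num)
        nlinarith
      have h1 := (aux_hat_norm f (Aop f (δ (j x)) τ x) (e x) x).2
      have h2 := aux_dir_norm f (Aop f (δ (j x)) τ x) (e x) (he x) x (1 / (2 * C))
        (by positivity) ?_
      · refine le_trans (mul_le_of_le_one_left (norm_nonneg _) hγ) (h1.trans h2)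
      · intro v hv
        have h3 := hinv v
        rw [hv] at h3
        have h4 : ‖(Aop f (δ (j x)) τ x - hessOp f z) v‖ ≤ 1 / (2 * C) := by
          refine (ContinuousLinearMap.le_opNorm _ _).trans ?_
          rw [hv, mul_one]
          exact (hx _).le
        have h5 : 1 / C ≤ ‖hessOp f z v‖ := by
          rw [div_le_iff₀ hC]
          linarith
        have h6 : ‖hessOp f z v‖ - ‖Aop f (δ (j x)) τ x v‖ ≤
            ‖(Aop f (δ (j x)) τ x - hessOp f z) v‖ := by
          rw [sub_apply, norm_sub_rev]
          exact norm_sub_norm_le _ _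
        have h7 : 1 / C = 2 * (1 / (2 * C)) := by field_simp
        linarith
  have hlim : Tendsto (fun x => m * (‖gradient f x‖ / (1 / (2 * C)))) (𝓝 z) (𝓝 0) := by
    have hcont : Continuous (fun x => (m:ℝ) * (‖gradient f x‖ / (1 / (2 * C)))) :=
      continuous_const.mul ((aux_grad f hf).continuous.norm.div_const _)
    have := hcont.tendsto z
    simpa [hz] using this
  have h0 : Tendsto (fun x => H x - x) (𝓝 z) (𝓝 0) := squeeze_zero_norm' hbd hlim
  simpa using h0.add tendsto_id

lemma aux_Alem {m : ℕ} (hm : 1 ≤ m) (δ : Fin (m + 1) → ℝ) (hδ : Function.Injective δ)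
    (τ γ0 : ℝ) (hτ : 0 < τ) (hγ0 : 0 < γ0)
    (f : Euc m → ℝ) (hf : ContDiff ℝ 3 f)
    (e : Euc m → Fin m → Euc m) (j : Euc m → Fin (m + 1)) (H : Euc m → Euc m)
    (he : ∀ z : Euc m, Orthonormal ℝ (e z))
    (hH : ∀ z : Euc m, IsQNGStep δ τ γ0 f (e z) (j z) z (H z))
    (z : Euc m) (hz : gradient f z ≠ 0) : ∃ d > 0, ∀ᶠ x in 𝓝 z, f (H x) ≤ f x - d := by
  have hgc := (aux_grad f hf).continuous
  have hκ := aux_kappa hm δ hδ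
  -- an upper bound for the norms of the operators
  obtain ⟨M, hM, hMev⟩ : ∃ M > 0, ∀ᶠ x in 𝓝 z, ∀ i, ‖Aop f (δ i) τ x‖ < M := by
    refine ⟨1 + ∑ i, ‖Aop f (δ i) τ z‖, by positivity, ?_⟩
    rw [eventually_all]
    intro i
    refine (aux_A f hf (δ i) τ hτ).norm.continuousAt.eventually (gt_mem_nhds ?_)
    have := Finset.single_le_sum (f := fun i => ‖Aop f (δ i) τ z‖)
      (fun i _ => norm_nonneg _) (Finset.mem_univ i)
    linarith
  have hgpos : 0 < ‖gradient f z‖ := norm_pos_iff.mpr hz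
  obtain ⟨W, hW, hWev⟩ : ∃ W ≥ 1, ∀ᶠ x in 𝓝 z,
      m * (‖gradient f x‖ / (kappa δ * ‖gradient f x‖ ^ τ)) < W := by
    refine ⟨1 + m * (‖gradient f z‖ / (kappa δ * ‖gradient f z‖ ^ τ)), ?_, ?_⟩
    · have : 0 ≤ m * (‖gradient f z‖ / (kappa δ * ‖gradient f z‖ ^ τ)) := by positivity
      linarith
    · have hc : ContinuousAt
          (fun x => m * (‖gradient f x‖ / (kappa δ * ‖gradient f x‖ ^ τ))) z := by
        refine continuousAt_const.mul (hgc.norm.continuousAt.div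
          (continuousAt_const.mul
            (hgc.norm.rpow_const (fun _ => Or.inr hτ.le)).continuousAt) ?_)
        positivity
      exact hc.eventually (gt_mem_nhds (by linarith))
  have hhalf : ∀ᶠ x in 𝓝 z, ‖gradient f z‖ / 2 < ‖gradient f x‖ :=
    hgc.norm.continuousAt.eventually (lt_mem_nhds (by linarith))
  set c : ℝ := (‖gradient f z‖ / 2) ^ 2 / (M * W) with hcdef
  have hW0 : 0 < W := by linarith
  have hc : 0 < c := by positivity
  have hcev : ∀ᶠ x in 𝓝 z, gradient f x ≠ 0 ∧
      c ≤ ⟪hatW f (Aop f (δ (j x)) τ x) (e x) x, gradient f x⟫ := by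
    filter_upwards [hMev, hWev, hhalf] with x h1 h2 h3
    have hg : 0 < ‖gradient f x‖ := by linarith
    have hg0 : gradient f x ≠ 0 := norm_pos_iff.mp hg
    refine ⟨hg0, ?_⟩
    obtain ⟨hgood, -⟩ := (hH x).2 hg0
    have hlow : ∀ v, ‖v‖ = 1 →
        kappa δ * ‖gradient f x‖ ^ τ ≤ ‖Aop f (δ (j x)) τ x v‖ :=
      fun v hv => le_trans hgood (aux_minsp _ v hv)
    have hpos : 0 < kappa δ * ‖gradient f x‖ ^ τ := by positivity
    have hw := aux_dir_norm f (Aop f (δ (j x)) τ x) (e x) (he x) x _ hpos hlow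
    unfold hatW
    rw [real_inner_smul_left, aux_inner]
    have hmax : max 1 ‖dirW f (Aop f (δ (j x)) τ x) (e x) x‖ ≤ W := max_le hW (by linarith)
    have hmax0 : 0 < max 1 ‖dirW f (Aop f (δ (j x)) τ x) (e x) x‖ :=
      lt_of_lt_of_le one_pos (le_max_left _ _)
    have hsum : ‖gradient f x‖ ^ 2 / M ≤
        ∑ i, ⟪gradient f x, e x i⟫ ^ 2 / ‖Aop f (δ (j x)) τ x (e x i)‖ := by
      rw [← aux_parseval (e x) (he x), Finset.sum_div]
      refine Finset.sum_le_sum fun i _ => ?_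
      have h4 := hlow _ ((he x).1 i)
      have h5 : ‖Aop f (δ (j x)) τ x (e x i)‖ ≤ M := by
        have := (Aop f (δ (j x)) τ x).le_opNorm (e x i)
        rw [(he x).1 i, mul_one] at this
        exact this.trans (h1 _).le
      exact div_le_div_of_nonneg_left (sq_nonneg _) (by linarith) h5
    calc c = W⁻¹ * ((‖gradient f z‖ / 2) ^ 2 / M) := by rw [hcdef]; field_simp
      _ ≤ W⁻¹ * (‖gradient f x‖ ^ 2 / M) := by gcongr
      _ ≤ _ := mul_le_mul (inv_anti₀ hmax0 hmax) hsum (by positivity) (by positivity)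
  -- strict differentiability
  have hstrict : HasStrictFDerivAt f (fderiv ℝ f z) z :=
    hf.contDiffAt.hasStrictFDerivAt (by norm_num)
  have hlo := hstrict.isLittleO.def (c := c / 3) (by positivity)
  rw [Metric.eventually_nhds_iff] at hlo
  obtain ⟨r, hr, hlo⟩ := hlo
  obtain ⟨p0, hp0⟩ := exists_pow_lt_of_lt_one (show 0 < r / 2 / γ0 by positivity)
    (show (1:ℝ) / 3 < 1 by norm_num)
  have hp0' : γ0 * (1 / 3) ^ p0 < r / 2 := by
    rw [lt_div_iff₀ hγ0] at hp0
    linarith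
  refine ⟨γ0 * (1 / 3) ^ p0 * c / 3, by positivity, ?_⟩
  have hgclose : ∀ᶠ x in 𝓝 z, ‖gradient f x - gradient f z‖ < c / 3 := by
    have := (Metric.tendsto_nhds.mp (hgc.tendsto z)) (c / 3) (by positivity)
    simpa [dist_eq_norm] using this
  filter_upwards [hcev, hgclose, Metric.ball_mem_nhds z (half_pos hr)] with x hx1 hx2 hx3
  obtain ⟨hg0, hcx⟩ := hx1
  obtain ⟨-, -, p, harm, hmin, hp⟩ := (hH x).2 hg0
  have hn1 := (aux_hat_norm f (Aop f (δ (j x)) τ x) (e x) x).1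
  set w := hatW f (Aop f (δ (j x)) τ x) (e x) x with hw
  have harm0 : armijo f x w (γ0 * (1 / 3) ^ p0) := by
    unfold armijo
    set γ := γ0 * (1 / 3) ^ p0 with hγ
    have hγpos : 0 < γ := by positivity
    have hnw : ‖γ • w‖ ≤ γ := by
      rw [norm_smul, Real.norm_of_nonneg hγpos.le]
      exact mul_le_of_le_one_right hγpos.le hn1
    have hx3' : dist x z < r / 2 := hx3
    have h1 := hlo (y := (x - γ • w, x)) (by
      rw [Prod.dist_eq, max_lt_iff]
      refine ⟨?_, by simp only; linarith⟩
      calc dist (x - γ • w) z ≤ dist (x - γ • w) x + dist x z := dist_triangle _ _ _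
        _ < r := by
          rw [dist_eq_norm, sub_sub_cancel_left, norm_neg]
          linarith)
    simp only [sub_sub_cancel_left, norm_neg, map_neg, map_smul, smul_eq_mul] at h1
    have h2 : fderiv ℝ f z w = ⟪gradient f z, w⟫ := by
      unfold gradient
      rw [InnerProductSpace.toDual_symm_apply]
    rw [h2, Real.norm_eq_abs] at h1
    have h3 := (abs_le.mp h1).2
    have h4 : |⟪gradient f x - gradient f z, w⟫| ≤ c / 3 := by
      refine (abs_real_inner_le_norm _ _).trans ?_
      nlinarith [norm_nonneg w, norm_nonneg (gradient f x - gradient f z)]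
    rw [inner_sub_left] at h4
    have h5 := (abs_le.mp h4).2
    rw [real_inner_comm] at hcx ⊢
    nlinarith [mul_le_mul_of_nonneg_left h5 hγpos.le, mul_le_mul_of_nonneg_left hcx hγpos.le,
      mul_le_mul_of_nonneg_left hnw (show 0 ≤ c / 3 by positivity)]
  have hpp : p ≤ p0 := by
    by_contra hlt
    exact hmin p0 (not_le.mp hlt) harm0
  have hγle : γ0 * (1 / 3) ^ p0 ≤ γ0 * (1 / 3) ^ p := by
    refine mul_le_mul_of_nonneg_left ?_ hγ0.le
    exact pow_le_pow_of_le_one (by norm_num) (by norm_num) hpp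
  unfold armijo at harm
  rw [← hp] at harm
  have := mul_le_mul hγle hcx hc.le (by positivity)
  linarith

/-- (Morse functions.) Let `f` be a `C³` Morse function and suppose the algorithm's basis is
given by a fixed assignment `z ↦ e z` (with selected index `j z`), so the update is a fixed
map `H`. Then there is a Lebesgue-null set `E₀` such that for every `x_0 ∉ E₀`, the sequence
`x_n = H^[n] x_0` either satisfies `‖x_n‖ → ∞` or converges to a critical point of `f`;
moreover if `f` has compact sublevels, only the second alternative occurs. -/
theorem stmt9 {m : ℕ} (hm : 1 ≤ m) (δ : Fin (m + 1) → ℝ) (hδ : Function.Injective δ)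
    (τ γ0 : ℝ) (hτ : 0 < τ) (hγ0 : 0 < γ0) (hγ1 : γ0 < 1)
    (f : Euc m → ℝ) (hf : ContDiff ℝ 3 f)
    (hMorse : ∀ z : Euc m, gradient f z = 0 → IsUnit (hessOp f z))
    (e : Euc m → Fin m → Euc m) (j : Euc m → Fin (m + 1)) (H : Euc m → Euc m)
    (he : ∀ z : Euc m, Orthonormal ℝ (e z))
    (hH : ∀ z : Euc m, IsQNGStep δ τ γ0 f (e z) (j z) z (H z)) :
    ∃ E₀ : Set (Euc m), MeasureTheory.volume E₀ = 0 ∧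
      ∀ x0 : Euc m, x0 ∉ E₀ →
        ((Tendsto (fun n => ‖H^[n] x0‖) atTop atTop ∨
          ∃ xinf : Euc m, gradient f xinf = 0 ∧
            Tendsto (fun n => H^[n] x0) atTop (𝓝 xinf)) ∧
        ((∀ a : ℝ, IsCompact {y : Euc m | f y ≤ a}) →
          ∃ xinf : Euc m, gradient f xinf = 0 ∧
            Tendsto (fun n => H^[n] x0) atTop (𝓝 xinf))) := by
  have hgc := (aux_grad f hf).continuous
  have hfc : Continuous f := hf.continuous
  have hdec : ∀ x, f (H x) ≤ f x := by
    intro x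
    by_cases hg : gradient f x = 0
    · rw [(hH x).1 hg]
    · obtain ⟨-, -, p, harm, -, hp⟩ := (hH x).2 hg
      unfold armijo at harm
      rw [← hp] at harm
      have h1 := aux_hat_inner f (Aop f (δ (j x)) τ x) (e x) x
      have h2 := mul_nonneg (show 0 ≤ γ0 * (1 / 3) ^ p by positivity) h1
      linarith
  have hA := aux_Alem hm δ hδ τ γ0 hτ hγ0 f hf e j H he hH
  have hcl : ∀ x0 z, MapClusterPt z atTop (fun n => H^[n] x0) → ∃ xinf : Euc m,
      gradient f xinf = 0 ∧ Tendsto (fun n => H^[n] x0) atTop (𝓝 xinf) := by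
    intro x0 z hz
    have hcrit := aux_cluster f hfc H hdec hA x0
    have hz0 := hcrit z hz
    obtain ⟨u, hu⟩ := hMorse z hz0
    have hinv : ∃ C > 0, ∀ v, ‖v‖ ≤ C * ‖hessOp f z v‖ := by
      refine ⟨‖(↑u⁻¹ : Euc m →L[ℝ] Euc m)‖ + 1, by positivity, fun v => ?_⟩
      have h1 : (↑u⁻¹ : Euc m →L[ℝ] Euc m) (hessOp f z v) = v := by
        rw [← hu, ← ContinuousLinearMap.mul_apply, Units.inv_mul]
        rfl
      have h2 := (↑u⁻¹ : Euc m →L[ℝ] Euc m).le_opNorm (hessOp f z v)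
      rw [h1] at h2
      nlinarith [norm_nonneg (hessOp f z v)]
    obtain ⟨C, hC, hinv⟩ := hinv
    refine ⟨z, hz0, aux_conv f H x0 z hz hcrit ?_
      (aux_B δ τ γ0 hτ hγ0 hγ1 f hf e j H he hH z hz0 C hC hinv)⟩
    have hd : HasFDerivAt (gradient f) (hessOp f z) z :=
      ((aux_grad f hf).differentiable (by norm_num) z).hasFDerivAt
    exact hd.eventually_ne ⟨⟨C, hC.le⟩, AddMonoidHomClass.antilipschitz_of_bound _ hinv⟩
  refine ⟨∅, by simp, fun x0 _ => ⟨?_, ?_⟩⟩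
  · by_cases h : Tendsto (fun n => ‖H^[n] x0‖) atTop atTop
    · exact Or.inl h
    · right
      rw [tendsto_atTop] at h
      push Not at h
      obtain ⟨R, hR⟩ := h
      have hfr : ∃ᶠ n in atTop, H^[n] x0 ∈ Metric.closedBall (0 : Euc m) R := by
        refine hR.mono fun n hn => ?_
        rw [mem_closedBall_zero_iff]
        exact hn.le
      obtain ⟨z, -, hz⟩ := (isCompact_closedBall (0 : Euc m) R).exists_mapClusterPt_of_frequently hfr
      exact hcl x0 z hz
  · intro hcomp
    have hmem : ∀ n, H^[n] x0 ∈ {y : Euc m | f y ≤ f x0} := by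
      intro n
      induction n with
      | zero => exact le_refl (f x0)
      | succ n ih =>
        rw [Function.iterate_succ_apply']
        exact le_trans (hdec _) ih
    obtain ⟨z, -, hz⟩ := (hcomp (f x0)).exists_mapClusterPt_of_frequently
      (Frequently.of_forall hmem : ∃ᶠ n in atTop, H^[n] x0 ∈ {y : Euc m | f y ≤ f x0})
    exact hcl x0 z hz
end
end
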